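/- Let Γ be a countable discrete group, p ∈ [1,∞], and ρ_n : Γ → U(k_n) a sequence of maps satisfying ‖ρ_n(gh) − ρ_n(g)ρ_n(h)‖_p → 0 for all g, h ∈ Γ. Then there exists a sequence ψ_n : Γ → U(k_n) with ψ_n(1) = 1 and ψ_n(g⁻¹) = ψ_n(g)* for all g, such that ‖ψ_n(g) − ρ_n(g)‖_p → 0 for all g ∈ Γ. -/

import Mathlib

open scoped ComplexOrder Topology
open Filter

/-- The unnormalized Schatten `p`-norm of a square complex matrix (for `p < ∞`). -/
noncomputable def schattenNorm {n : ℕ} (p : ℝ) (M : Matrix (Fin n) (Fin n) ℂ) : ℝ :=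
  (∑ i, (((Matrix.posSemidef_conjTranspose_mul_self M).1).eigenvalues i) ^ (p / 2)) ^ (1 / p)

/-- The operator norm of a square complex matrix, acting on `ℓ²`. -/
noncomputable def opNorm {n : ℕ} (M : Matrix (Fin n) (Fin n) ℂ) : ℝ :=
  ‖Matrix.toEuclideanCLM (𝕜 := ℂ) M‖

/-- `pNorm p M` is the unnormalized Schatten `p`-norm for `p < ∞`, and the
operator norm for `p = ∞`. -/
noncomputable def pNorm {n : ℕ} (p : ENNReal) (M : Matrix (Fin n) (Fin n) ℂ) : ℝ :=
  if p = ⊤ then opNorm M else schattenNorm p.toReal M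

open MeasureTheory in
lemma aux_layer (y : ℝ) : ENNReal.ofReal y = ∫⁻ s in Set.Ici (0:ℝ), (Set.Iio y).indicator 1 s := by
  rw [lintegral_indicator_one measurableSet_Iio, Measure.restrict_apply measurableSet_Iio,
    Set.inter_comm, Set.Ici_inter_Iio, Real.volume_Ico, sub_zero]

open MeasureTheory in
lemma aux_sum_le {ι κ : Type*} [Fintype ι] [Fintype κ] (f : ι → ℝ) (g : κ → ℝ)
    (hf : ∀ i, 0 ≤ f i) (hg : ∀ i, 0 ≤ g i)
    (h : ∀ s : ℝ, 0 ≤ s → Fintype.card {i // s < f i} ≤ Fintype.card {i // s < g i}) :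
    ∑ i, f i ≤ ∑ i, g i := by
  have key : ∀ {α : Type _} [Fintype α] (u : α → ℝ) (s : ℝ),
      ∑ i, (Set.Iio (u i)).indicator (1 : ℝ → ENNReal) s = (Fintype.card {i // s < u i} : ENNReal) := by
    intro α _ u s
    classical
    simp only [Set.indicator_apply, Set.mem_Iio, Pi.one_apply]
    rw [Finset.sum_boole, Fintype.card_subtype]
  have key' : ∀ {α : Type _} [Fintype α] (u : α → ℝ) (s : ℝ),
      ∑ i, (Set.Iio (u i)).indicator (1 : ℝ → ENNReal) s = (Fintype.card {i // s < u i} : ENNReal) := by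
    intro α _ u s
    classical
    simp only [Set.indicator_apply, Set.mem_Iio, Pi.one_apply]
    rw [Finset.sum_boole, Fintype.card_subtype]
  rw [← ENNReal.ofReal_le_ofReal_iff (Finset.sum_nonneg fun i _ => hg i),
    ENNReal.ofReal_sum_of_nonneg fun i _ => hf i, ENNReal.ofReal_sum_of_nonneg fun i _ => hg i]
  simp_rw [aux_layer]
  rw [← lintegral_finsetSum _ fun i _ => measurable_one.indicator measurableSet_Iio,
    ← lintegral_finsetSum _ fun i _ => measurable_one.indicator measurableSet_Iio]
  refine setLIntegral_mono' measurableSet_Ici fun s hs => ?_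
  rw [key, key']
  exact_mod_cast h s hs

noncomputable def aux_ev {n : ℕ} (M : Matrix (Fin n) (Fin n) ℂ) : Fin n → ℝ :=
  ((Matrix.posSemidef_conjTranspose_mul_self M).1).eigenvalues

noncomputable def aux_b {n : ℕ} (M : Matrix (Fin n) (Fin n) ℂ) :
    OrthonormalBasis (Fin n) ℂ (EuclideanSpace ℂ (Fin n)) :=
  ((Matrix.posSemidef_conjTranspose_mul_self M).1).eigenvectorBasis

lemma aux_ev_nonneg {n : ℕ} (M : Matrix (Fin n) (Fin n) ℂ) (i : Fin n) : 0 ≤ aux_ev M i :=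
  (Matrix.posSemidef_conjTranspose_mul_self M).eigenvalues_nonneg i

lemma aux_eig {n : ℕ} (M : Matrix (Fin n) (Fin n) ℂ) (i : Fin n) :
    Matrix.toEuclideanCLM (𝕜 := ℂ) (star M * M) (aux_b M i) = (aux_ev M i : ℂ) • aux_b M i := by
  have := ((Matrix.posSemidef_conjTranspose_mul_self M).1).mulVec_eigenvectorBasis i
  ext j
  have := congrFun this j
  simpa [aux_b, aux_ev, Matrix.star_eq_conjTranspose] using this

lemma aux_inner {n : ℕ} (M : Matrix (Fin n) (Fin n) ℂ) (x y : EuclideanSpace ℂ (Fin n)) :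
    inner ℂ (Matrix.toEuclideanCLM (𝕜 := ℂ) M x) (Matrix.toEuclideanCLM (𝕜 := ℂ) M y)
      = inner ℂ x (Matrix.toEuclideanCLM (𝕜 := ℂ) (star M * M) y) := by
  rw [map_mul, map_star, ContinuousLinearMap.star_eq_adjoint, mul_apply_eq_comp,
    ContinuousLinearMap.adjoint_inner_right]

lemma aux_norm_sq {n : ℕ} (M : Matrix (Fin n) (Fin n) ℂ) (x : EuclideanSpace ℂ (Fin n)) :
    ‖Matrix.toEuclideanCLM (𝕜 := ℂ) M x‖ ^ 2 = ∑ i, aux_ev M i * ‖inner ℂ (aux_b M i) x‖ ^ 2 := by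
  have h1 : ((‖Matrix.toEuclideanCLM (𝕜 := ℂ) M x‖ ^ 2 : ℝ) : ℂ)
      = ((∑ i, aux_ev M i * ‖inner ℂ (aux_b M i) x‖ ^ 2 : ℝ) : ℂ) := by
    have h2 := inner_self_eq_norm_sq_to_K (𝕜 := ℂ) (Matrix.toEuclideanCLM (𝕜 := ℂ) M x)
    rw [aux_inner] at h2
    push_cast
    refine h2.symm.trans ?_
    conv_lhs => rw [← (aux_b M).sum_repr' x]
    rw [map_sum]
    conv_lhs =>
      enter [3, 2, i]
      rw [map_smul, aux_eig]
    rw [(aux_b M).sum_repr' x, inner_sum]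
    refine Finset.sum_congr rfl fun i _ => ?_
    rw [inner_smul_right, inner_smul_right, ← inner_conj_symm x (aux_b M i)]
    rw [← Complex.mul_conj']
    ring
  exact_mod_cast h1

lemma aux_card {n : ℕ} (M A B : Matrix (Fin n) (Fin n) ℂ)
    (h : ∀ x, ‖Matrix.toEuclideanCLM (𝕜 := ℂ) M x‖ ≤
      ‖Matrix.toEuclideanCLM (𝕜 := ℂ) A x‖ + ‖Matrix.toEuclideanCLM (𝕜 := ℂ) B x‖)
    (t : ℝ) :
    Fintype.card {i // 4 * t < aux_ev M i} ≤
      Fintype.card {i // t < aux_ev A i} + Fintype.card {i // t < aux_ev B i} := by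
  by_contra! hc
  let L : EuclideanSpace ℂ (Fin n) →ₗ[ℂ]
      (({i // ¬ 4 * t < aux_ev M i} → ℂ) × (({i // t < aux_ev A i} → ℂ) × ({i // t < aux_ev B i} → ℂ))) :=
    LinearMap.prod (LinearMap.pi fun i => (innerSL ℂ (aux_b M i)).toLinearMap)
      (LinearMap.prod (LinearMap.pi fun i => (innerSL ℂ (aux_b A i)).toLinearMap)
        (LinearMap.pi fun i => (innerSL ℂ (aux_b B i)).toLinearMap))
  have hd : Module.finrank ℂ (({i // ¬ 4 * t < aux_ev M i} → ℂ) × (({i // t < aux_ev A i} → ℂ) × ({i // t < aux_ev B i} → ℂ)))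
      < Module.finrank ℂ (EuclideanSpace ℂ (Fin n)) := by
    simp only [Module.finrank_prod, Module.finrank_fintype_fun_eq_card, finrank_euclideanSpace]
    have := Fintype.card_subtype_compl (fun i => 4 * t < aux_ev M i)
    have h3 := Fintype.card_subtype_le (fun i => 4 * t < aux_ev M i)
    omega
  have hk := LinearMap.ker_ne_bot_of_finrank_lt (f := L) hd
  obtain ⟨x, hx, hx0⟩ := (Submodule.ne_bot_iff _).1 hk
  rw [LinearMap.mem_ker] at hx
  have hM : ∀ i, ¬ 4 * t < aux_ev M i → inner ℂ (aux_b M i) x = 0 := fun i hi =>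
    congrFun (congrArg Prod.fst hx) ⟨i, hi⟩
  have hA : ∀ i, t < aux_ev A i → inner ℂ (aux_b A i) x = 0 := fun i hi =>
    congrFun (congrArg (fun z => z.2.1) hx) ⟨i, hi⟩
  have hB : ∀ i, t < aux_ev B i → inner ℂ (aux_b B i) x = 0 := fun i hi =>
    congrFun (congrArg (fun z => z.2.2) hx) ⟨i, hi⟩
  have up : ∀ C : Matrix (Fin n) (Fin n) ℂ, (∀ i, t < aux_ev C i → inner ℂ (aux_b C i) x = 0) →
      ‖Matrix.toEuclideanCLM (𝕜 := ℂ) C x‖ ^ 2 ≤ t * ‖x‖ ^ 2 := by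
    intro C hC
    rw [aux_norm_sq, ← (aux_b C).sum_sq_norm_inner_right x, Finset.mul_sum]
    refine Finset.sum_le_sum fun i _ => ?_
    by_cases hi : t < aux_ev C i
    · simp [hC i hi]
    · exact mul_le_mul_of_nonneg_right (not_lt.1 hi) (by positivity)
  have lo : 4 * t * ‖x‖ ^ 2 < ‖Matrix.toEuclideanCLM (𝕜 := ℂ) M x‖ ^ 2 := by
    rw [aux_norm_sq, ← (aux_b M).sum_sq_norm_inner_right x, Finset.mul_sum]
    obtain ⟨i, hi⟩ : ∃ i, inner ℂ (aux_b M i) x ≠ 0 := by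
      by_contra! hall
      apply hx0
      rw [← (aux_b M).sum_repr' x]
      simp [hall]
    refine Finset.sum_lt_sum (fun j _ => ?_) ⟨i, Finset.mem_univ _, ?_⟩
    · by_cases hj : 4 * t < aux_ev M j
      · exact mul_le_mul_of_nonneg_right hj.le (by positivity)
      · simp [hM j hj]
    · have : 4 * t < aux_ev M i := by
        by_contra hj
        exact hi (hM i hj)
      exact mul_lt_mul_of_pos_right this (by positivity)
  have u1 := up A hA
  have u2 := up B hB
  have := h x
  have h0 := norm_nonneg (Matrix.toEuclideanCLM (𝕜 := ℂ) M x)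
  nlinarith [sq_nonneg (‖Matrix.toEuclideanCLM (𝕜 := ℂ) A x‖ - ‖Matrix.toEuclideanCLM (𝕜 := ℂ) B x‖)]

lemma aux_pNorm_nonneg {n : ℕ} (p : ENNReal) (M : Matrix (Fin n) (Fin n) ℂ) : 0 ≤ pNorm p M := by
  unfold pNorm
  split_ifs
  · exact norm_nonneg _
  · exact Real.rpow_nonneg (Finset.sum_nonneg fun i _ => Real.rpow_nonneg (aux_ev_nonneg M i) _) _

lemma aux_schatten {n : ℕ} (p : ℝ) (hp : 1 ≤ p) (M A B : Matrix (Fin n) (Fin n) ℂ)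
    (h : ∀ x, ‖Matrix.toEuclideanCLM (𝕜 := ℂ) M x‖ ≤
      ‖Matrix.toEuclideanCLM (𝕜 := ℂ) A x‖ + ‖Matrix.toEuclideanCLM (𝕜 := ℂ) B x‖) :
    schattenNorm p M ≤ 2 * (schattenNorm p A + schattenNorm p B) := by
  have hp0 : 0 < p := by linarith
  have hq : 0 < p / 2 := by linarith
  have nn : ∀ C : Matrix (Fin n) (Fin n) ℂ, 0 ≤ ∑ i, aux_ev C i ^ (p / 2) := fun C =>
    Finset.sum_nonneg fun i _ => Real.rpow_nonneg (aux_ev_nonneg C i) _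
  have e : ∀ C : Matrix (Fin n) (Fin n) ℂ, schattenNorm p C = (∑ i, aux_ev C i ^ (p / 2)) ^ (1 / p) :=
    fun C => rfl
  have sn : ∀ C : Matrix (Fin n) (Fin n) ℂ, 0 ≤ schattenNorm p C := fun C => by
    rw [e]; exact Real.rpow_nonneg (nn C) _
  have ep : ∀ C : Matrix (Fin n) (Fin n) ℂ, schattenNorm p C ^ p = ∑ i, aux_ev C i ^ (p / 2) := fun C => by
    rw [e, ← Real.rpow_mul (nn C), one_div_mul_cancel hp0.ne', Real.rpow_one]
  have main : ∑ i, (aux_ev M i / 4) ^ (p / 2) ≤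
      ∑ i, aux_ev A i ^ (p / 2) + ∑ i, aux_ev B i ^ (p / 2) := by
    have := aux_sum_le (fun i => (aux_ev M i / 4) ^ (p / 2))
      (Sum.elim (fun i => aux_ev A i ^ (p / 2)) (fun i => aux_ev B i ^ (p / 2)))
      (fun i => Real.rpow_nonneg (div_nonneg (aux_ev_nonneg M i) (by norm_num)) _)
      (by rintro (i | i) <;> exact Real.rpow_nonneg (aux_ev_nonneg _ i) _) ?_
    · simpa using this
    · intro s hs
      have hc := aux_card M A B h (s ^ (p / 2)⁻¹)
      have conv : ∀ z : ℝ, 0 ≤ z → (s < z ^ (p / 2) ↔ s ^ (p / 2)⁻¹ < z) := fun z hz =>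
        (Real.rpow_inv_lt_iff_of_pos hs hz hq).symm
      rw [Fintype.card_congr (Equiv.subtypeSum), Fintype.card_sum]
      have e1 : ∀ i, s < (aux_ev M i / 4) ^ (p / 2) ↔ 4 * s ^ (p / 2)⁻¹ < aux_ev M i := fun i => by
        rw [conv _ (div_nonneg (aux_ev_nonneg M i) (by norm_num)), lt_div_iff₀ (by norm_num), mul_comm]
      rw [Fintype.card_congr (Equiv.subtypeEquivRight e1)]
      refine hc.trans (le_of_eq (congrArg₂ (· + ·) ?_ ?_))
      · exact Fintype.card_congr (Equiv.subtypeEquivRight fun i => (conv _ (aux_ev_nonneg A i)).symm)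
      · exact Fintype.card_congr (Equiv.subtypeEquivRight fun i => (conv _ (aux_ev_nonneg B i)).symm)
  have h4 : (4:ℝ) ^ (p / 2) = 2 ^ p := by
    rw [show (4:ℝ) = 2 ^ (2:ℝ) by norm_num, ← Real.rpow_mul (by norm_num)]
    congr 1; ring
  have main2 : schattenNorm p M ^ p ≤ 2 ^ p * (schattenNorm p A ^ p + schattenNorm p B ^ p) := by
    rw [ep, ep, ep, ← h4]
    calc _ = 4 ^ (p / 2) * ∑ i, (aux_ev M i / 4) ^ (p / 2) := by
          rw [Finset.mul_sum]
          refine Finset.sum_congr rfl fun i _ => ?_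
          rw [← Real.mul_rpow (by norm_num) (div_nonneg (aux_ev_nonneg M i) (by norm_num))]
          congr 1; ring
      _ ≤ _ := by gcongr
  rw [← Real.rpow_le_rpow_iff (sn M) (by have := sn A; have := sn B; positivity) hp0,
    Real.mul_rpow (by norm_num) (add_nonneg (sn A) (sn B))]
  refine main2.trans ?_
  gcongr
  exact Real.add_rpow_le_rpow_add (sn A) (sn B) hp

lemma aux_pNorm {n : ℕ} (p : ENNReal) (hp : 1 ≤ p) (M A B : Matrix (Fin n) (Fin n) ℂ)
    (h : ∀ x, ‖Matrix.toEuclideanCLM (𝕜 := ℂ) M x‖ ≤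
      ‖Matrix.toEuclideanCLM (𝕜 := ℂ) A x‖ + ‖Matrix.toEuclideanCLM (𝕜 := ℂ) B x‖) :
    pNorm p M ≤ 2 * (pNorm p A + pNorm p B) := by
  unfold pNorm
  split_ifs with hpt
  · have : opNorm M ≤ opNorm A + opNorm B := by
      refine ContinuousLinearMap.opNorm_le_bound _ (add_nonneg (norm_nonneg _) (norm_nonneg _)) fun x => ?_
      rw [add_mul]
      exact (h x).trans (add_le_add (ContinuousLinearMap.le_opNorm _ _) (ContinuousLinearMap.le_opNorm _ _))
    have h1 : 0 ≤ opNorm A := norm_nonneg _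
    have h2 : 0 ≤ opNorm B := norm_nonneg _
    linarith
  · refine aux_schatten _ ?_ _ _ _ h
    rw [← ENNReal.toReal_one]
    exact (ENNReal.toReal_le_toReal ENNReal.one_ne_top hpt).2 hp

lemma aux_unit {n : ℕ} (U : Matrix.unitaryGroup (Fin n) ℂ) (x : EuclideanSpace ℂ (Fin n)) :
    ‖Matrix.toEuclideanCLM (𝕜 := ℂ) (U : Matrix (Fin n) (Fin n) ℂ) x‖ = ‖x‖ := by
  have h := aux_inner (U : Matrix (Fin n) (Fin n) ℂ) x x
  rw [(Matrix.mem_unitaryGroup_iff').1 U.2, map_one] at h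
  simp only [one_apply_eq_self, inner_self_eq_norm_sq_to_K] at h
  have h' : ‖Matrix.toEuclideanCLM (𝕜 := ℂ) (U : Matrix (Fin n) (Fin n) ℂ) x‖ ^ 2 = ‖x‖ ^ 2 := by
    exact_mod_cast h
  exact (sq_eq_sq₀ (norm_nonneg _) (norm_nonneg _)).1 h'

lemma aux_sgn {n : ℕ} (U K : Matrix (Fin n) (Fin n) ℂ) (hK : K.IsHermitian) (hc : U * K = K * U) :
    ∃ S : Matrix (Fin n) (Fin n) ℂ, star S = S ∧ S * S = 1 ∧ U * S = S * U ∧ (S * K).PosSemidef := by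
  obtain ⟨V, hV1, hV2, d, hd⟩ : ∃ V : Matrix (Fin n) (Fin n) ℂ, star V * V = 1 ∧ V * star V = 1 ∧
      ∃ d : Fin n → ℝ, K = V * Matrix.diagonal (fun i => (d i : ℂ)) * star V := by
    refine ⟨hK.eigenvectorUnitary, (Matrix.mem_unitaryGroup_iff').1 hK.eigenvectorUnitary.2,
      (Matrix.mem_unitaryGroup_iff).1 hK.eigenvectorUnitary.2, hK.eigenvalues, ?_⟩
    have := hK.spectral_theorem
    simpa [Unitary.conjStarAlgAut_apply, Function.comp_def] using this
  let s : Fin n → ℂ := fun i => if 0 < d i then 1 else -1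
  have can : ∀ X Y : Matrix (Fin n) (Fin n) ℂ, (V * X * star V) * (V * Y * star V) = V * (X * Y) * star V := by
    intro X Y
    calc _ = V * X * (star V * V) * Y * star V := by simp only [mul_assoc]
      _ = _ := by rw [hV1]; simp only [mul_assoc, mul_one]
  have hss : ∀ i, s i * s i = 1 := fun i => by simp only [s]; split_ifs <;> simp
  refine ⟨V * Matrix.diagonal s * star V, ?_, ?_, ?_, ?_⟩
  · rw [star_mul, star_mul, star_star, mul_assoc]
    congr 2
    rw [Matrix.star_eq_conjTranspose, Matrix.diagonal_conjTranspose]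
    congr 1
    ext i
    simp only [s, Pi.star_apply]; split_ifs <;> simp
  · rw [can, Matrix.diagonal_mul_diagonal]
    simp [hss, hV2]
  · obtain ⟨W, hW⟩ : ∃ W, U = V * W * star V := ⟨star V * U * V, by
      calc U = (V * star V) * U * (V * star V) := by simp [hV2]
        _ = _ := by simp only [mul_assoc]⟩
    have inj : ∀ X Y : Matrix (Fin n) (Fin n) ℂ, V * X * star V = V * Y * star V → X = Y := by
      intro X Y h
      calc X = (star V * V) * X * (star V * V) := by simp [hV1]
        _ = star V * (V * X * star V) * V := by simp only [mul_assoc]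
        _ = star V * (V * Y * star V) * V := by rw [h]
        _ = (star V * V) * Y * (star V * V) := by simp only [mul_assoc]
        _ = Y := by simp [hV1]
    rw [hW, hd, can, can] at hc
    have hc := inj _ _ hc
    rw [hW, can, can]
    congr 2
    ext i j
    have := congrFun (congrFun hc i) j
    rw [Matrix.mul_diagonal, Matrix.diagonal_mul] at this ⊢
    by_cases hij : d i = d j
    · simp only [s, hij]; ring
    · have h0 : W i j = 0 := by
        have h1 : W i j * ((d j : ℂ) - d i) = 0 := by linear_combination this
        rcases mul_eq_zero.1 h1 with h | h
        · exact h
        · exact absurd (by exact_mod_cast (sub_eq_zero.1 h).symm) hij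
      simp [h0]
  · rw [hd, can, Matrix.diagonal_mul_diagonal, Matrix.star_eq_conjTranspose]
    refine Matrix.PosSemidef.mul_mul_conjTranspose_same (Matrix.PosSemidef.diagonal fun i => ?_) V
    simp only [s, Pi.zero_apply]
    split_ifs with h
    · simpa using h.le
    · have h' : ((d i : ℝ) : ℂ) ≤ 0 := by exact_mod_cast not_lt.1 h
      simpa using h'

lemma aux_inv {n : ℕ} (U : Matrix.unitaryGroup (Fin n) ℂ) :
    ∃ S : Matrix.unitaryGroup (Fin n) ℂ, star (S : Matrix (Fin n) (Fin n) ℂ) = S ∧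
      ∀ x, ‖Matrix.toEuclideanCLM (𝕜 := ℂ) ((S : Matrix (Fin n) (Fin n) ℂ) - (U : Matrix (Fin n) (Fin n) ℂ)) x‖ ≤
        ‖Matrix.toEuclideanCLM (𝕜 := ℂ) (1 - (U : Matrix (Fin n) (Fin n) ℂ) * (U : Matrix (Fin n) (Fin n) ℂ)) x‖ := by
  obtain ⟨U, hU⟩ := U
  have hU1 := (Matrix.mem_unitaryGroup_iff').1 hU
  have hU2 := (Matrix.mem_unitaryGroup_iff).1 hU
  obtain ⟨S, hS1, hS2, hS3, hS4⟩ := aux_sgn U (U + star U)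
    (by rw [Matrix.IsHermitian, ← Matrix.star_eq_conjTranspose, star_add, star_star, add_comm])
    (by rw [mul_add, add_mul, hU1, hU2])
  refine ⟨⟨S, (Matrix.mem_unitaryGroup_iff).2 (by rw [hS1, hS2])⟩, hS1, fun x => ?_⟩
  simp only
  have hS3' : star U * S = S * star U := by
    have := congrArg star hS3
    rw [star_mul, star_mul, hS1] at this
    exact this.symm
  have hf : 1 - U * U = (U + S) * (S - U) := by
    rw [add_mul, mul_sub, mul_sub, hS2, hS3]; abel
  rw [hf, map_mul, mul_apply_eq_comp]
  set y := Matrix.toEuclideanCLM (𝕜 := ℂ) (S - U) x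
  have hi := aux_inner (U + S) y y
  have hq : star (U + S) * (U + S) = (1 + 1) + S * (U + star U) := by
    rw [star_add, hS1, add_mul, mul_add, mul_add, hU1, hS2, hS3', mul_add]; abel
  rw [hq, map_add _ (1 + 1), map_add _ 1 1, map_one, inner_self_eq_norm_sq_to_K] at hi
  simp only [add_apply, one_apply_eq_self, inner_add_right,
    inner_self_eq_norm_sq_to_K] at hi
  generalize S * (U + star U) = T at hS4 hi
  have hpos : 0 ≤ RCLike.re (inner ℂ y (Matrix.toEuclideanCLM (𝕜 := ℂ) T y)) := by
    have := hS4.re_dotProduct_nonneg (WithLp.ofLp y)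
    simpa [EuclideanSpace.inner_eq_star_dotProduct, dotProduct_comm] using this
  have hr : ‖Matrix.toEuclideanCLM (𝕜 := ℂ) (U + S) y‖ ^ 2 = ‖y‖ ^ 2 + ‖y‖ ^ 2 +
      RCLike.re (inner ℂ y (Matrix.toEuclideanCLM (𝕜 := ℂ) T y)) := by
    have c : ∀ r : ℝ, RCLike.re ((((r : ℝ) : ℂ)) ^ 2) = r ^ 2 := fun r => by
      rw [← Complex.ofReal_pow]; exact Complex.ofReal_re _
    have hr := congrArg (RCLike.re (K := ℂ)) hi
    rw [map_add (RCLike.re (K := ℂ)), map_add (RCLike.re (K := ℂ))] at hr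
    refine (c _).symm.trans (hr.trans ?_)
    exact congrArg₂ (· + ·) (congrArg₂ (· + ·) (c _) (c _)) rfl
  refine (sq_le_sq₀ (norm_nonneg _) (norm_nonneg _)).1 ?_
  nlinarith [sq_nonneg ‖y‖]

theorem stmt9 {Γ : Type*} [Group Γ] [Countable Γ] (p : ENNReal) (hp : 1 ≤ p)
    (k : ℕ → ℕ) (ρ : ∀ n : ℕ, Γ → Matrix.unitaryGroup (Fin (k n)) ℂ)
    (hmul : ∀ g h : Γ, Tendsto
      (fun n => pNorm p ((ρ n (g * h) : Matrix (Fin (k n)) (Fin (k n)) ℂ) -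
        (ρ n g : Matrix (Fin (k n)) (Fin (k n)) ℂ) * (ρ n h : Matrix (Fin (k n)) (Fin (k n)) ℂ)))
      atTop (𝓝 0)) :
    ∃ ψ : ∀ n : ℕ, Γ → Matrix.unitaryGroup (Fin (k n)) ℂ,
      (∀ n, (ψ n 1 : Matrix (Fin (k n)) (Fin (k n)) ℂ) = 1) ∧
      (∀ n (g : Γ), (ψ n g⁻¹ : Matrix (Fin (k n)) (Fin (k n)) ℂ) =
        star (ψ n g : Matrix (Fin (k n)) (Fin (k n)) ℂ)) ∧
      (∀ g : Γ, Tendsto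
        (fun n => pNorm p ((ψ n g : Matrix (Fin (k n)) (Fin (k n)) ℂ) -
          (ρ n g : Matrix (Fin (k n)) (Fin (k n)) ℂ))) atTop (𝓝 0)) := by
  classical
  obtain ⟨e, he⟩ := exists_injective_nat Γ
  choose S hS1 hS2 using fun n g => aux_inv (ρ n g)
  have sq : ∀ (M A B : ∀ n, Matrix (Fin (k n)) (Fin (k n)) ℂ),
      (∀ n x, ‖Matrix.toEuclideanCLM (𝕜 := ℂ) (M n) x‖ ≤
      ‖Matrix.toEuclideanCLM (𝕜 := ℂ) (A n) x‖ + ‖Matrix.toEuclideanCLM (𝕜 := ℂ) (B n) x‖) →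
      Tendsto (fun n => pNorm p (A n)) atTop (𝓝 0) → Tendsto (fun n => pNorm p (B n)) atTop (𝓝 0) →
      Tendsto (fun n => pNorm p (M n)) atTop (𝓝 0) := by
    intro M A B h hA hB
    have := (hA.add hB).const_mul 2
    simp only [add_zero, mul_zero] at this
    exact squeeze_zero (fun n => aux_pNorm_nonneg _ _) (fun n => aux_pNorm p hp _ _ _ (h n)) this
  have mono : ∀ (M A : ∀ n, Matrix (Fin (k n)) (Fin (k n)) ℂ),
      (∀ n x, ‖Matrix.toEuclideanCLM (𝕜 := ℂ) (M n) x‖ ≤ ‖Matrix.toEuclideanCLM (𝕜 := ℂ) (A n) x‖) →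
      Tendsto (fun n => pNorm p (A n)) atTop (𝓝 0) →
      Tendsto (fun n => pNorm p (M n)) atTop (𝓝 0) := fun M A h hA =>
    sq M A A (fun n x => (h n x).trans (le_add_of_nonneg_left (norm_nonneg _))) hA hA
  have one : Tendsto (fun n => pNorm p ((1 : Matrix (Fin (k n)) (Fin (k n)) ℂ) - (ρ n 1: Matrix (Fin (k n)) (Fin (k n)) ℂ))) atTop (𝓝 0) := by
    refine mono _ _ (fun n x => ?_) (hmul 1 1)
    have : ((ρ n (1 * 1) : Matrix (Fin (k n)) (Fin (k n)) ℂ) - (ρ n 1: Matrix (Fin (k n)) (Fin (k n)) ℂ) * (ρ n 1: Matrix (Fin (k n)) (Fin (k n)) ℂ)) = (ρ n 1: Matrix (Fin (k n)) (Fin (k n)) ℂ) * (1 - (ρ n 1: Matrix (Fin (k n)) (Fin (k n)) ℂ)) := by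
      rw [mul_one (1:Γ), mul_sub, mul_one]
    rw [this, map_mul, mul_apply_eq_comp, aux_unit]
  have inv : ∀ g h : Γ, g * h = 1 → Tendsto (fun n => pNorm p
      ((1 : Matrix (Fin (k n)) (Fin (k n)) ℂ) - (ρ n g: Matrix (Fin (k n)) (Fin (k n)) ℂ) * (ρ n h: Matrix (Fin (k n)) (Fin (k n)) ℂ))) atTop (𝓝 0) := by
    intro g h hgh
    refine sq _ _ _ (fun n x => ?_) one (hmul g h)
    rw [hgh]
    refine le_trans (le_of_eq ?_) (norm_add_le _ _)
    rw [← add_apply, ← map_add, sub_add_sub_cancel]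
  refine ⟨fun n g => if g = 1 then 1 else if g⁻¹ = g then S n g else
    if e g < e g⁻¹ then ρ n g else star (ρ n g⁻¹), fun n => by simp, fun n g => ?_, fun g => ?_⟩
  · by_cases h1 : g = 1
    · simp [h1]
    by_cases h2 : g⁻¹ = g
    · simp only [h2, h1, if_true, if_false]
      exact (hS1 n g).symm
    have h3 : ¬ g = g⁻¹ := fun h => h2 h.symm
    have h4 : e g ≠ e g⁻¹ := fun h => h3 (he h)
    simp only [inv_eq_one, h1, inv_inv, h2, h3, if_false]
    rcases lt_or_gt_of_ne h4 with h | h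
    · simp [h, h.not_gt]
    · simp [h, h.not_gt]
  · by_cases h1 : g = 1
    · subst h1
      simpa using one
    by_cases h2 : g⁻¹ = g
    · simp only [h2, h1, if_true, if_false]
      exact mono _ _ (fun n x => hS2 n g x) (inv g g (by nth_rewrite 1 [← h2]; simp))
    simp only [h1, h2, if_false]
    by_cases h3 : e g < e g⁻¹
    · simp only [h3, if_true]
      refine mono _ _ (fun n x => ?_) (hmul 1 1)
      simp
    · simp only [h3, if_false]
      refine mono _ _ (fun n x => ?_) (inv g⁻¹ g (by simp))
      have : (1 : Matrix (Fin (k n)) (Fin (k n)) ℂ) - (ρ n g⁻¹: Matrix (Fin (k n)) (Fin (k n)) ℂ) * (ρ n g: Matrix (Fin (k n)) (Fin (k n)) ℂ)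
          = (ρ n g⁻¹: Matrix (Fin (k n)) (Fin (k n)) ℂ) * (((star (ρ n g⁻¹) : Matrix.unitaryGroup (Fin (k n)) ℂ) : Matrix (Fin (k n)) (Fin (k n)) ℂ) - (ρ n g: Matrix (Fin (k n)) (Fin (k n)) ℂ)) := by
        rw [mul_sub]
        congr 1
        exact ((Matrix.mem_unitaryGroup_iff).1 (ρ n g⁻¹).2).symm
      rw [this, map_mul, mul_apply_eq_comp, aux_unit]
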